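/- There exist ε′ > 0 and C > 0, depending only on n, λ, Λ, such that for every short-geodesic trajectory with data (y₀, η₀, s) with 0 < s < ε′ one has ξ′(t) < 0 for all t ∈ (0,T) and x(t) ≤ C s for all t ∈ [0,T]. -/

import Mathlib

open Set

noncomputable section

/-- `quadForm M v w = ⟨M v, w⟩`, the bilinear form of the matrix `M` with respect to the
standard inner product on `ℝ^m`. -/
def quadForm {m : ℕ} (M : Matrix (Fin m) (Fin m) ℝ) (v w : Fin m → ℝ) : ℝ :=
  ∑ i, (∑ j, M i j * v j) * w i

/-- The Euclidean norm of a vector in `ℝ^m`. -/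
def euclNorm {m : ℕ} (v : Fin m → ℝ) : ℝ :=
  Real.sqrt (∑ i, v i ^ 2)

/-- Entrywise partial derivative `∂ₓ A` of a matrix-valued map in its first (scalar) variable. -/
def dxA {m : ℕ} (A : ℝ → (Fin m → ℝ) → Matrix (Fin m) (Fin m) ℝ)
    (x : ℝ) (y : Fin m → ℝ) : Matrix (Fin m) (Fin m) ℝ :=
  Matrix.of fun i j => deriv (fun x' => A x' y i j) x

/-- Entrywise partial derivative `∂_{y k} A` of a matrix-valued map in the `k`-th component of
its second (vector) variable. -/
def dyA {m : ℕ} (A : ℝ → (Fin m → ℝ) → Matrix (Fin m) (Fin m) ℝ)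
    (k : Fin m) (x : ℝ) (y : Fin m → ℝ) : Matrix (Fin m) (Fin m) ℝ :=
  Matrix.of fun i j => deriv (fun s => A x (Function.update y k s) i j) (y k)

/-- Partial derivative `∂ₓ f` of a scalar function of `(x, y)`. -/
def dxF {m : ℕ} (f : ℝ → (Fin m → ℝ) → ℝ) (x : ℝ) (y : Fin m → ℝ) : ℝ :=
  deriv (fun x' => f x' y) x

/-- Partial derivative `∂_{y k} f` of a scalar function of `(x, y)`. -/
def dyF {m : ℕ} (f : ℝ → (Fin m → ℝ) → ℝ) (k : Fin m) (x : ℝ) (y : Fin m → ℝ) : ℝ :=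
  deriv (fun s => f x (Function.update y k s)) (y k)

/-- Iterated partial derivative `∂ₓ^k f` of a scalar function of `(x, y)`. -/
def dxIter {m : ℕ} : ℕ → (ℝ → (Fin m → ℝ) → ℝ) → ℝ → (Fin m → ℝ) → ℝ
  | 0, f => f
  | (k+1), f => dxF (dxIter k f)

/-- The standing hypotheses on the data of a gas giant in `g`-boundary normal coordinates:
`n ≥ 2`, `ε ∈ (0,1]`, `U ⊆ ℝ^{n-1}` open, and `A : [0,ε) × U → ℝ^{(n-1)×(n-1)}` symmetric
positive definite (with uniform ellipticity constants `0 < lam ≤ Lam`), extending to a `C^∞`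
map on an open neighborhood of `[0,ε) × U`, with all first-order partial derivatives of all
entries bounded by `Lam`.  (`A` plays the role of the inverse boundary metric `h^{ij}` of the
gas giant metric `g = dx² + x⁻² h(x,y,dy)`.) -/
structure GasGiantData (n : ℕ) (ε : ℝ) (U : Set (Fin (n-1) → ℝ))
    (A : ℝ → (Fin (n-1) → ℝ) → Matrix (Fin (n-1)) (Fin (n-1)) ℝ)
    (lam Lam : ℝ) : Prop where
  hn : 2 ≤ n
  hε : ε ∈ Set.Ioc (0:ℝ) 1
  hU : IsOpen U
  hlam : 0 < lam
  hlamLam : lam ≤ Lam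
  hsymm : ∀ x ∈ Set.Ico (0:ℝ) ε, ∀ y ∈ U, (A x y).IsSymm
  hsmooth : ∃ W : Set (ℝ × (Fin (n-1) → ℝ)), IsOpen W ∧ Set.Ico (0:ℝ) ε ×ˢ U ⊆ W ∧
    ∀ i j, ContDiffOn ℝ (⊤ : ℕ∞) (fun p : ℝ × (Fin (n-1) → ℝ) => A p.1 p.2 i j) W
  hposdef : ∀ x ∈ Set.Ico (0:ℝ) ε, ∀ y ∈ U, ∀ v : Fin (n-1) → ℝ,
    lam * (∑ i, v i ^ 2) ≤ quadForm (A x y) v v ∧ quadForm (A x y) v v ≤ Lam * (∑ i, v i ^ 2)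
  hderivBound : ∀ x ∈ Set.Ico (0:ℝ) ε, ∀ y ∈ U,
    (∀ i j, |dxA A x y i j| ≤ Lam) ∧ (∀ k i j, |dyA A k x y i j| ≤ Lam)

/-- A Hamiltonian trajectory on the interval `I` for the gas giant Hamiltonian
`H(x,y,ξ,η) = ½ ξ² + ½ x² ⟨A(x,y)η, η⟩`: a `C¹` curve
`t ↦ (x(t), y(t), ξ(t), η(t)) ∈ [0,ε) × U × ℝ × ℝ^{n-1}` satisfying Hamilton's equations. -/
structure IsHamTraj (n : ℕ) (ε : ℝ) (U : Set (Fin (n-1) → ℝ))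
    (A : ℝ → (Fin (n-1) → ℝ) → Matrix (Fin (n-1)) (Fin (n-1)) ℝ) (I : Set ℝ)
    (x : ℝ → ℝ) (y : ℝ → Fin (n-1) → ℝ) (ξ : ℝ → ℝ) (η : ℝ → Fin (n-1) → ℝ) : Prop where
  mem : ∀ t ∈ I, x t ∈ Set.Ico (0:ℝ) ε ∧ y t ∈ U
  hx : ∀ t ∈ I, HasDerivAt x (ξ t) t
  hy : ∀ t ∈ I, ∀ i, HasDerivAt (fun t' => y t' i)
    ((x t)^2 * ∑ j, A (x t) (y t) i j * η t j) t
  hxi : ∀ t ∈ I, HasDerivAt ξ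
    (-(x t * quadForm (A (x t) (y t)) (η t) (η t))
      - (1/2) * (x t)^2 * quadForm (dxA A (x t) (y t)) (η t) (η t)) t
  heta : ∀ t ∈ I, ∀ i, HasDerivAt (fun t' => η t' i)
    (-(1/2) * (x t)^2 * quadForm (dyA A i (x t) (y t)) (η t) (η t)) t

/-- A short-geodesic trajectory with data `(y₀, η₀, s)`: a Hamiltonian trajectory on `[0,T]`,
`T > 0`, with initial value `(0, y₀, s, η₀)`, with `x(T) = 0` and `x(t) > 0` on `(0,T)`. -/
def IsShortGeo (n : ℕ) (ε : ℝ) (U : Set (Fin (n-1) → ℝ))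
    (A : ℝ → (Fin (n-1) → ℝ) → Matrix (Fin (n-1)) (Fin (n-1)) ℝ)
    (y₀ η₀ : Fin (n-1) → ℝ) (s T : ℝ)
    (x : ℝ → ℝ) (y : ℝ → Fin (n-1) → ℝ) (ξ : ℝ → ℝ) (η : ℝ → Fin (n-1) → ℝ) : Prop :=
  0 < T ∧ IsHamTraj n ε U A (Set.Icc 0 T) x y ξ η ∧
    x 0 = 0 ∧ y 0 = y₀ ∧ ξ 0 = s ∧ η 0 = η₀ ∧ x T = 0 ∧ ∀ t ∈ Set.Ioo 0 T, 0 < x t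

lemma quadForm_flip {m : ℕ} {M : Matrix (Fin m) (Fin m) ℝ} (hM : M.IsSymm)
    (v w : Fin m → ℝ) : quadForm M v w = quadForm M w v := by
  simp only [quadForm, Finset.sum_mul]
  rw [Finset.sum_comm]
  refine Finset.sum_congr rfl fun i _ => Finset.sum_congr rfl fun j _ => ?_
  rw [hM.apply i j]
  ring

lemma quadForm_lincomb {m : ℕ} (a : ℝ) (b : Fin m → ℝ) (M : Matrix (Fin m) (Fin m) ℝ)
    (N : Fin m → Matrix (Fin m) (Fin m) ℝ) (v w : Fin m → ℝ) :
    quadForm (Matrix.of fun i j => a * M i j + ∑ k, b k * N k i j) v w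
      = a * quadForm M v w + ∑ k, b k * quadForm (N k) v w := by
  simp only [quadForm, Matrix.of_apply, add_mul, Finset.sum_add_distrib, Finset.mul_sum,
    Finset.sum_mul]
  congr 1
  · simp only [mul_assoc]
  · conv_rhs => rw [Finset.sum_comm]
    refine Finset.sum_congr rfl fun i _ => ?_
    conv_rhs => rw [Finset.sum_comm]
    exact Finset.sum_congr rfl fun j _ => Finset.sum_congr rfl fun k _ => by ring

lemma abs_quadForm_le {m : ℕ} {M : Matrix (Fin m) (Fin m) ℝ} {K : ℝ}
    (hM : ∀ i j, |M i j| ≤ K) (v : Fin m → ℝ) :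
    |quadForm M v v| ≤ K * m * ∑ i, v i ^ 2 := by
  have hrow : ∀ i j, |M i j * v j * v i| ≤ K * ((v i ^ 2 + v j ^ 2) / 2) := by
    intro i j
    have h1 : |v j * v i| ≤ (v i ^ 2 + v j ^ 2) / 2 := by
      rw [abs_le]
      constructor <;> nlinarith [sq_nonneg (v i + v j), sq_nonneg (v i - v j)]
    rw [mul_assoc, abs_mul]
    exact mul_le_mul (hM i j) h1 (abs_nonneg _) ((abs_nonneg _).trans (hM i j))
  calc |quadForm M v v| ≤ ∑ i, ∑ j, K * ((v i ^ 2 + v j ^ 2) / 2) := by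
        simp only [quadForm, Finset.sum_mul]
        refine (Finset.abs_sum_le_sum_abs _ _).trans (Finset.sum_le_sum fun i _ => ?_)
        exact (Finset.abs_sum_le_sum_abs _ _).trans (Finset.sum_le_sum fun j _ => hrow i j)
    _ = K * m * ∑ i, v i ^ 2 := by
        simp only [← Finset.mul_sum, ← Finset.sum_div, Finset.sum_add_distrib, Finset.sum_const,
          Finset.card_univ, Fintype.card_fin, nsmul_eq_mul]
        ring

lemma sum_sq_le_of_abs_sub_le {m : ℕ} {v w : Fin m → ℝ} {d : ℝ}
    (h : ∀ i, |v i - w i| ≤ d) : ∑ i, w i ^ 2 ≤ 2 * ∑ i, v i ^ 2 + 2 * m * d ^ 2 := by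
  have hi : ∀ i, w i ^ 2 ≤ 2 * v i ^ 2 + 2 * d ^ 2 := fun i => by
    have := sq_le_sq' (abs_le.1 (h i)).1 (abs_le.1 (h i)).2
    nlinarith [sq_nonneg (2 * v i - w i)]
  refine (Finset.sum_le_sum fun i _ => hi i).trans_eq ?_
  simp only [Finset.sum_add_distrib, ← Finset.mul_sum, Finset.sum_const, Finset.card_univ,
    Fintype.card_fin, nsmul_eq_mul]
  ring

lemma HasDerivAt.quadForm {m : ℕ} {M : ℝ → Matrix (Fin m) (Fin m) ℝ}
    {M' : Matrix (Fin m) (Fin m) ℝ} {v w : ℝ → Fin m → ℝ} {v' w' : Fin m → ℝ} {t : ℝ}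
    (hM : ∀ i j, HasDerivAt (fun t' => M t' i j) (M' i j) t)
    (hv : ∀ i, HasDerivAt (fun t' => v t' i) (v' i) t)
    (hw : ∀ i, HasDerivAt (fun t' => w t' i) (w' i) t) :
    HasDerivAt (fun t' => _root_.quadForm (M t') (v t') (w t'))
      (_root_.quadForm M' (v t) (w t) + _root_.quadForm (M t) v' (w t)
        + _root_.quadForm (M t) (v t) w') t := by
  have h := HasDerivAt.fun_sum (u := Finset.univ) fun i _ =>
    (HasDerivAt.fun_sum (u := Finset.univ) fun j _ => (hM i j).mul (hv j)).mul (hw i)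
  refine h.congr_deriv ?_
  simp only [_root_.quadForm, Finset.sum_add_distrib, add_mul, Pi.mul_apply]

/-- Chain rule along a curve, in terms of partial derivatives. -/
lemma DifferentiableAt.hasDerivAt_comp_partials {m : ℕ} {f : ℝ → (Fin m → ℝ) → ℝ}
    {x : ℝ → ℝ} {y : ℝ → Fin m → ℝ} {x' : ℝ} {y' : Fin m → ℝ} {t : ℝ}
    (hf : DifferentiableAt ℝ (fun p : ℝ × (Fin m → ℝ) => f p.1 p.2) (x t, y t))
    (hx : HasDerivAt x x' t) (hy : ∀ k, HasDerivAt (fun t' => y t' k) (y' k) t) :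
    HasDerivAt (fun t' => f (x t') (y t'))
      (x' * dxF f (x t) (y t) + ∑ k, y' k * dyF f k (x t) (y t)) t := by
  have hF := hf.hasFDerivAt
  set L := fderiv ℝ (fun p : ℝ × (Fin m → ℝ) => f p.1 p.2) (x t, y t)
  have hcomp : HasDerivAt (fun t' => f (x t') (y t')) (L (x', y')) t :=
    HasFDerivAt.comp_hasDerivAt (f := fun t' => (x t', y t')) t hF
      (hx.prodMk (hasDerivAt_pi.2 hy))
  have hdx : dxF f (x t) (y t) = L (1, 0) :=
    HasDerivAt.deriv <| HasFDerivAt.comp_hasDerivAt (f := fun x' => (x', y t)) (x t) hF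
      ((hasDerivAt_id (x t)).prodMk (hasDerivAt_const (x t) (y t)))
  have hdy : ∀ k, dyF f k (x t) (y t) = L (0, Pi.single k 1) := fun k => by
    have hF' : HasFDerivAt (fun p : ℝ × (Fin m → ℝ) => f p.1 p.2) L
        (x t, Function.update (y t) k (y t k)) := by rwa [Function.update_eq_self]
    exact HasDerivAt.deriv <| HasFDerivAt.comp_hasDerivAt
      (f := fun s => (x t, Function.update (y t) k s)) (y t k) hF'
      ((hasDerivAt_const (y t k) (x t)).prodMk (hasDerivAt_update (y t) k (y t k)))
  refine hcomp.congr_deriv ?_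
  have hsplit : ((x', y') : ℝ × (Fin m → ℝ))
      = x' • (1, 0) + ∑ k, y' k • ((0, Pi.single k 1) : ℝ × (Fin m → ℝ)) := by
    refine Prod.ext ?_ ?_
    · simp [Prod.fst_sum]
    · ext i
      simp [Prod.snd_sum, Finset.sum_apply, Pi.single_apply]
  rw [hsplit, map_add, map_smul, map_sum, hdx]
  simp only [map_smul, hdy, smul_eq_mul]

/-- The Hamiltonian is constant along Hamiltonian trajectories. -/
lemma IsHamTraj.hasDerivAt_energy {n : ℕ} {ε lam Lam : ℝ} {U : Set (Fin (n-1) → ℝ)}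
    {A : ℝ → (Fin (n-1) → ℝ) → Matrix (Fin (n-1)) (Fin (n-1)) ℝ} {I : Set ℝ}
    {x : ℝ → ℝ} {y : ℝ → Fin (n-1) → ℝ} {ξ : ℝ → ℝ} {η : ℝ → Fin (n-1) → ℝ}
    (hA : GasGiantData n ε U A lam Lam) (h : IsHamTraj n ε U A I x y ξ η) {t : ℝ} (ht : t ∈ I) :
    HasDerivAt (fun t => ξ t ^ 2 + x t ^ 2 * quadForm (A (x t) (y t)) (η t) (η t)) 0 t := by
  obtain ⟨W, hWo, hW, hAW⟩ := hA.hsmooth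
  have hmem := h.mem t ht
  have hdiff : ∀ i j, DifferentiableAt ℝ
      (fun p : ℝ × (Fin (n-1) → ℝ) => A p.1 p.2 i j) (x t, y t) := fun i j =>
    ((hAW i j).contDiffAt (hWo.mem_nhds (hW ⟨hmem.1, hmem.2⟩))).differentiableAt (by simp)
  have hq := HasDerivAt.quadForm
    (M' := Matrix.of fun i j => ξ t * dxA A (x t) (y t) i j
      + ∑ k, ((x t)^2 * ∑ j, A (x t) (y t) k j * η t j) * dyA A k (x t) (y t) i j)
    (fun i j => (hdiff i j).hasDerivAt_comp_partials (f := fun x y => A x y i j)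
      (h.hx t ht) (h.hy t ht)) (h.heta t ht) (h.heta t ht)
  refine (((h.hxi t ht).pow 2).add (((h.hx t ht).pow 2).mul hq)).congr_deriv ?_
  rw [quadForm_lincomb, quadForm_flip (hA.hsymm _ hmem.1 _ hmem.2)
    (fun k => -(1/2) * (x t)^2 * quadForm (dyA A k (x t) (y t)) (η t) (η t)) (η t)]
  have hcancel : ∑ k, ((x t)^2 * ∑ j, A (x t) (y t) k j * η t j)
        * quadForm (dyA A k (x t) (y t)) (η t) (η t)
      = -2 * quadForm (A (x t) (y t)) (η t)
        (fun k => -(1/2) * (x t)^2 * quadForm (dyA A k (x t) (y t)) (η t) (η t)) := by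
    rw [quadForm, Finset.mul_sum]
    exact Finset.sum_congr rfl fun k _ => by ring
  rw [hcancel]
  push_cast
  simp only [Pi.pow_apply]
  ring

lemma eq_of_hasDerivAt_zero {f : ℝ → ℝ} {T : ℝ} (h : ∀ t ∈ Icc 0 T, HasDerivAt f 0 t)
    {t : ℝ} (ht : t ∈ Icc 0 T) : f t = f 0 :=
  constant_of_has_deriv_right_zero (fun t ht => (h t ht).continuousAt.continuousWithinAt)
    (fun t ht => (h t (Ico_subset_Icc_self ht)).hasDerivWithinAt) t ht

/-- Sturm comparison: a positive solution of `u'' ≤ -ω² u` vanishing at `0` has a zero by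
time `π / ω`. -/
lemma nonpos_of_sturm {ω : ℝ} (hω : 0 < ω) {u v w : ℝ → ℝ} (hu0 : u 0 = 0)
    (hu : ∀ t ∈ Icc 0 (Real.pi / ω), HasDerivAt u (v t) t)
    (hv : ∀ t ∈ Icc 0 (Real.pi / ω), HasDerivAt v (w t) t)
    (hw : ∀ t ∈ Icc 0 (Real.pi / ω), w t ≤ -(ω ^ 2 * u t)) :
    u (Real.pi / ω) ≤ 0 := by
  have hT : 0 ≤ Real.pi / ω := by positivity
  have hs : ∀ t, HasDerivAt (fun t => Real.sin (ω * t)) (Real.cos (ω * t) * ω) t := fun t => by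
    simpa using ((hasDerivAt_id t).const_mul ω).sin
  have hc : ∀ t, HasDerivAt (fun t => Real.cos (ω * t)) (-Real.sin (ω * t) * ω) t := fun t => by
    simpa using ((hasDerivAt_id t).const_mul ω).cos
  have hW : ∀ t ∈ Icc 0 (Real.pi / ω), HasDerivAt
      (fun t => v t * Real.sin (ω * t) - ω * (u t * Real.cos (ω * t)))
      ((w t + ω ^ 2 * u t) * Real.sin (ω * t)) t := fun t ht =>
    (((hv t ht).mul (hs t)).sub (((hu t ht).mul (hc t)).const_mul ω)).congr_deriv (by ring)
  have hanti : AntitoneOn (fun t => v t * Real.sin (ω * t) - ω * (u t * Real.cos (ω * t)))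
      (Icc 0 (Real.pi / ω)) := by
    refine antitoneOn_of_hasDerivWithinAt_nonpos (convex_Icc _ _)
      (fun t ht => (hW t ht).continuousAt.continuousWithinAt)
      (fun t ht => (hW t (interior_subset ht)).hasDerivWithinAt) fun t ht => ?_
    have ht' := interior_subset ht
    refine mul_nonpos_of_nonpos_of_nonneg (by linarith [hw t ht']) ?_
    refine Real.sin_nonneg_of_nonneg_of_le_pi (mul_nonneg hω.le ht'.1) ?_
    have := (le_div_iff₀ hω).1 ht'.2
    linarith
  have h := hanti (left_mem_Icc.2 hT) (right_mem_Icc.2 hT) hT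
  have hpi : ω * (Real.pi / ω) = Real.pi := by field_simp
  simp only [hpi, hu0, Real.sin_pi, Real.cos_pi, mul_zero, zero_mul, sub_zero, Real.sin_zero] at h
  nlinarith

/-- Along a Hamiltonian trajectory with energy `s² / 2`, each momentum component changes at
rate `O(s²)`. -/
lemma IsHamTraj.abs_eta_sub_le {n : ℕ} {ε lam Lam : ℝ} {U : Set (Fin (n-1) → ℝ)}
    {A : ℝ → (Fin (n-1) → ℝ) → Matrix (Fin (n-1)) (Fin (n-1)) ℝ} {T s : ℝ}
    {x : ℝ → ℝ} {y : ℝ → Fin (n-1) → ℝ} {ξ : ℝ → ℝ} {η : ℝ → Fin (n-1) → ℝ}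
    (hA : GasGiantData n ε U A lam Lam) (h : IsHamTraj n ε U A (Icc 0 T) x y ξ η)
    (hE : ∀ t ∈ Icc 0 T, x t ^ 2 * (lam * ∑ i, η t i ^ 2) ≤ s ^ 2) {t : ℝ}
    (ht : t ∈ Icc 0 T) (i : Fin (n-1)) :
    |η t i - η 0 i| ≤ Lam * (n - 1 : ℕ) / (2 * lam) * s ^ 2 * t := by
  have hlam := hA.hlam
  have hLam : 0 < Lam := hlam.trans_le hA.hlamLam
  have hb := norm_image_sub_le_of_norm_deriv_le_segment' (f := fun t => η t i) (a := 0) (b := T)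
    (C := Lam * (n - 1 : ℕ) / (2 * lam) * s ^ 2)
    (fun r hr => (h.heta r hr i).hasDerivWithinAt) ?_ t ht
  · simpa using hb
  intro r hr
  have hr' := Ico_subset_Icc_self hr
  have hmem := h.mem r hr'
  have hdq := abs_quadForm_le ((hA.hderivBound _ hmem.1 _ hmem.2).2 i) (η r)
  rw [Real.norm_eq_abs, abs_mul, abs_mul, abs_of_nonneg (sq_nonneg (x r))]
  norm_num
  calc 1 / 2 * x r ^ 2 * |quadForm (dyA A i (x r) (y r)) (η r) (η r)|
      ≤ 1 / 2 * x r ^ 2 * (Lam * (n - 1 : ℕ) * ∑ i, η r i ^ 2) := by gcongr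
    _ = Lam * (n - 1 : ℕ) / (2 * lam) * (x r ^ 2 * (lam * ∑ i, η r i ^ 2)) := by
        field_simp
    _ ≤ Lam * (n - 1 : ℕ) / (2 * lam) * s ^ 2 := by
        have := hE r hr'
        gcongr

/-- along short geodesics with small speed `s`, the normal momentum is strictly
decreasing and the height satisfies `x(t) ≤ C s`, with `ε'`, `C` depending only on
`n`, `lam`, `Lam`. -/
theorem stmt_6 (n : ℕ) (hn : 2 ≤ n) (lam Lam : ℝ) (hlam : 0 < lam) (hll : lam ≤ Lam) :
    ∃ ε' > (0:ℝ), ∃ C > (0:ℝ),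
      ∀ (ε : ℝ) (U : Set (Fin (n-1) → ℝ))
        (A : ℝ → (Fin (n-1) → ℝ) → Matrix (Fin (n-1)) (Fin (n-1)) ℝ),
        GasGiantData n ε U A lam Lam →
        ∀ (y₀ η₀ : Fin (n-1) → ℝ) (s T : ℝ)
          (x : ℝ → ℝ) (y : ℝ → Fin (n-1) → ℝ) (ξ : ℝ → ℝ) (η : ℝ → Fin (n-1) → ℝ),
          y₀ ∈ U → quadForm (A 0 y₀) η₀ η₀ = 1 → 0 < s → s < ε' →
          IsShortGeo n ε U A y₀ η₀ s T x y ξ η →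
          (∀ t ∈ Set.Ioo (0:ℝ) T, deriv ξ t < 0) ∧ (∀ t ∈ Set.Icc (0:ℝ) T, x t ≤ C * s) := by
  have hLam : 0 < Lam := hlam.trans_le hll
  set m : ℝ := ((n - 1 : ℕ) : ℝ) with hm
  have hm0 : 0 ≤ m := Nat.cast_nonneg _
  set ω : ℝ := Real.sqrt (lam / (8 * Lam)) with hω
  have hω0 : 0 < ω := Real.sqrt_pos.2 (by positivity)
  have hωsq : ω ^ 2 = lam / (8 * Lam) := Real.sq_sqrt (by positivity)
  set C : ℝ := Real.sqrt (4 * Lam / lam) with hC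
  have hC0 : 0 < C := Real.sqrt_pos.2 (by positivity)
  have hCsq : C ^ 2 = 4 * Lam / lam := Real.sq_sqrt (by positivity)
  obtain ⟨ε', hε', hsmall⟩ : ∃ ε' > (0:ℝ), ∀ s, 0 < s → s < ε' →
      C * s * (Lam * m / lam) < 1 ∧
      2 * m * (Lam * m / (2 * lam) * s ^ 2 * (Real.pi / ω)) ^ 2 < 1 / (2 * Lam) := by
    have h1 : ∀ᶠ s : ℝ in nhds 0, C * s * (Lam * m / lam) < 1 :=
      (Continuous.tendsto (by fun_prop) 0).eventually_lt_const (by simp)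
    have h2 : ∀ᶠ s : ℝ in nhds 0,
        2 * m * (Lam * m / (2 * lam) * s ^ 2 * (Real.pi / ω)) ^ 2 < 1 / (2 * Lam) :=
      (Continuous.tendsto (by fun_prop) 0).eventually_lt_const (by simp; positivity)
    obtain ⟨δ, hδ, h⟩ := Metric.eventually_nhds_iff.1 (h1.and h2)
    exact ⟨δ, hδ, fun s hs hsδ => h (by simpa [abs_of_pos hs] using hsδ)⟩
  refine ⟨ε', hε', C, hC0, ?_⟩
  rintro ε U A hA y₀ η₀ s T x y ξ η hy₀ hη₀ hs hsε ⟨hT, hH, hx0, rfl, hξ0, rfl, hxT, hxpos⟩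
  obtain ⟨hs1, hs2⟩ := hsmall s hs hsε
  have hE : ∀ t ∈ Icc 0 T, x t ^ 2 * (lam * ∑ i, η t i ^ 2) ≤ s ^ 2 := fun t ht => by
    have henergy := eq_of_hasDerivAt_zero (fun t ht => hH.hasDerivAt_energy hA ht) ht
    simp only [hx0, hξ0] at henergy
    have hmem := hH.mem t ht
    have := mul_le_mul_of_nonneg_left (hA.hposdef _ hmem.1 _ hmem.2 (η t)).1 (sq_nonneg (x t))
    nlinarith [sq_nonneg (ξ t)]
  have hN0 : 1 / Lam ≤ ∑ i, η 0 i ^ 2 := by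
    rw [div_le_iff₀' hLam, ← hη₀]
    exact (hA.hposdef 0 ⟨le_rfl, hA.hε.1⟩ _ hy₀ _).2
  have hN : ∀ t ∈ Icc 0 T, t ≤ Real.pi / ω → 1 / (4 * Lam) ≤ ∑ i, η t i ^ 2 := fun t ht htω => by
    have hd : ∀ i, |η t i - η 0 i| ≤ Lam * m / (2 * lam) * s ^ 2 * (Real.pi / ω) := fun i =>
      (hH.abs_eta_sub_le hA hE ht i).trans (by gcongr)
    have h1 := sum_sq_le_of_abs_sub_le hd
    have h2 : 1 / (4 * Lam) = (1 / Lam - 1 / (2 * Lam)) / 2 := by field_simp; norm_num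
    rw [← hm] at h1
    linarith
  have hxC : ∀ t ∈ Icc 0 T, t ≤ Real.pi / ω → x t ≤ C * s := fun t ht htω => by
    refine abs_le_of_sq_le_sq' ?_ (by positivity) |>.2
    have h1 := hE t ht
    have h2 := mul_le_mul_of_nonneg_left
      (mul_le_mul_of_nonneg_left (hN t ht htω) hlam.le) (sq_nonneg (x t))
    have h3 : x t ^ 2 = 4 * Lam / lam * (x t ^ 2 * (lam * (1 / (4 * Lam)))) := by field_simp
    rw [mul_pow, hCsq, h3]
    gcongr
    exact h2.trans h1
  have hξ' : ∀ t ∈ Icc 0 T, t ≤ Real.pi / ω →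
      -(x t * quadForm (A (x t) (y t)) (η t) (η t))
        - (1/2) * (x t)^2 * quadForm (dxA A (x t) (y t)) (η t) (η t) ≤ -(ω ^ 2 * x t) :=
      fun t ht htω => by
    have hmem := hH.mem t ht
    have hx := hmem.1.1
    have hq := (hA.hposdef _ hmem.1 _ hmem.2 (η t)).1
    have hdq := (abs_le.1 (abs_quadForm_le (hA.hderivBound _ hmem.1 _ hmem.2).1 (η t))).1
    rw [← hm] at hdq
    have hNt := hN t ht htω
    have hxs : x t * (Lam * m) ≤ lam := by
      have : x t * (Lam * m / lam) ≤ 1 :=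
        (mul_le_mul_of_nonneg_right (hxC t ht htω) (by positivity)).trans hs1.le
      rwa [← mul_div_assoc, div_le_one hlam] at this
    set N := ∑ i, η t i ^ 2
    have hN' : 0 ≤ N := le_trans (by positivity) hNt
    have hlow : ω ^ 2 ≤ lam * N / 2 := by
      have := mul_le_mul_of_nonneg_left hNt hlam.le
      have h8 : lam / (8 * Lam) = lam * (1 / (4 * Lam)) / 2 := by field_simp; norm_num
      rw [hωsq, h8]
      linarith
    have e1 : x t * (lam * N) ≤ x t * quadForm (A (x t) (y t)) (η t) (η t) :=
      mul_le_mul_of_nonneg_left hq hx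
    have e2 := mul_le_mul_of_nonneg_left hdq (sq_nonneg (x t))
    have e3 : x t * N * (x t * (Lam * m)) ≤ x t * N * lam :=
      mul_le_mul_of_nonneg_left hxs (by positivity)
    have e4 : x t * ω ^ 2 ≤ x t * (lam * N / 2) := mul_le_mul_of_nonneg_left hlow hx
    nlinarith
  have hTω : T ≤ Real.pi / ω := by
    by_contra! hlt
    have hpos := hxpos (Real.pi / ω) ⟨by positivity, hlt⟩
    have hsub : ∀ t ∈ Icc 0 (Real.pi / ω), t ∈ Icc 0 T := fun t ht => ⟨ht.1, ht.2.trans hlt.le⟩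
    exact hpos.not_ge (nonpos_of_sturm hω0 hx0 (fun t ht => hH.hx t (hsub t ht))
      (fun t ht => hH.hxi t (hsub t ht)) fun t ht => hξ' t (hsub t ht) ht.2)
  refine ⟨fun t ht => ?_, fun t ht => hxC t ht (ht.2.trans hTω)⟩
  have ht' := Ioo_subset_Icc_self ht
  rw [(hH.hxi t ht').deriv]
  have := hxpos t ht
  exact (hξ' t ht' (ht.2.le.trans hTω)).trans_lt (by simp only [neg_lt_zero]; positivity)
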